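/- arXiv:1709.08846 — 2 statements merged into one kernel-verified Lean document; each statement's English description precedes it below -/
import Mathlib

section
/- (Convexity argmin lemma.) Suppose Qₙ : Ω → (ℝ → ℝ ∪ {+∞}), n ≥ 1, are random convex lower-semicontinuous functions, Q_∞ is a random convex lower-semicontinuous function, and D ⊆ ℝ is dense, such that: (i) for every finite set {t₁, …, t_m} ⊆ D, the random vector (Qₙ(t₁), …, Qₙ(t_m)) converges in distribution to (Q_∞(t₁), …, Q_∞(t_m)); (ii) Q_∞ is almost surely finite over a nonempty open set 𝒵₀ ⊆ ℝ; and (iii) Q_∞ is almost surely uniquely minimized at a random variable Z_∞. Then any sequence of random variables Ẑₙ with Ẑₙ ∈ argmin_{z ∈ ℝ} Qₙ(z) converges in distribution to Z_∞. -/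
open MeasureTheory Filter Set
open scoped Topology ENNReal Classical BoundedContinuousFunction

/-- Convexity for extended-real-valued functions on `ℝ`. -/
def ConvexERealFn (g : ℝ → EReal) : Prop :=
  ∀ a b : ℝ, ∀ t : ℝ, 0 ≤ t → t ≤ 1 →
    g (t * a + (1 - t) * b) ≤ (t : EReal) * g a + ((1 - t : ℝ) : EReal) * g b

namespace ConvexERealFn

variable {g : ℝ → EReal}

/-- A convex function is quasiconvex. -/
lemma le_max (hg : ConvexERealFn g) {a z b : ℝ} (haz : a ≤ z) (hzb : z ≤ b) :
    g z ≤ max (g a) (g b) := by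
  obtain ⟨t, u, ht, hu, htu, rfl⟩ :=
    (Convex.mem_Icc (haz.trans hzb)).1 ⟨haz, hzb⟩
  obtain rfl : u = 1 - t := by linarith
  have ht' : (0 : EReal) ≤ (t : EReal) := by exact_mod_cast ht
  have hu' : (0 : EReal) ≤ ((1 - t : ℝ) : EReal) := by exact_mod_cast hu
  calc g (t * a + (1 - t) * b)
      ≤ (t : EReal) * g a + ((1 - t : ℝ) : EReal) * g b := hg a b t ht (by linarith)
    _ ≤ (t : EReal) * max (g a) (g b) + ((1 - t : ℝ) : EReal) * max (g a) (g b) := by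
        gcongr
        · exact le_max_left _ _
        · exact le_max_right _ _
    _ = max (g a) (g b) := by
        rw [← EReal.right_distrib_of_nonneg ht' hu', ← EReal.coe_add]
        simp

/-- A minimizer of a convex function lies between any two points
at which the value exceeds that at some intermediate point. -/
lemma minimizer_mem_Icc (hg : ConvexERealFn g) {a t b z : ℝ} (hat : a < t) (htb : t < b)
    (hga : g t < g a) (hgb : g t < g b) (hz : ∀ x, g z ≤ g x) : z ∈ Icc a b := by
  constructor <;> by_contra! h
  · exact (hg.le_max h.le hat.le).not_gt (max_lt ((hz t).trans_lt hga) hga)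
  · exact (hg.le_max htb.le h.le).not_gt (max_lt hgb ((hz t).trans_lt hgb))

/-- A convex function which is finite at `z` and at some other point has points with values close
to that at `z` in every neighbourhood of `z`, and these contain an open set. -/
lemma exists_isOpen_lt (hg : ConvexERealFn g) {z w : ℝ} (hwz : w ≠ z)
    (hz : g z ≠ ⊤ ∧ g z ≠ ⊥) (hw : g w ≠ ⊤ ∧ g w ≠ ⊥) {c : EReal} (hc : g z < c)
    {N : Set ℝ} (hN : N ∈ 𝓝 z) :
    ∃ s : Set ℝ, IsOpen s ∧ s.Nonempty ∧ s ⊆ N ∧ ∀ x ∈ s, g x < c := by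
  lift g z to ℝ using hz with p hp
  lift g w to ℝ using hw with q hq
  have hlim : ∀ᶠ l : ℝ in 𝓝 0, ((l * q + (1 - l) * p : ℝ) : EReal) < c := by
    have : ContinuousAt (fun l : ℝ => ((l * q + (1 - l) * p : ℝ) : EReal)) 0 :=
      (continuous_coe_real_ereal.comp (by fun_prop)).continuousAt
    exact this.eventually_lt_const (by simpa using hc)
  have hmem : ∀ᶠ l : ℝ in 𝓝 0, l * w + (1 - l) * z ∈ N := by
    have : ContinuousAt (fun l : ℝ => l * w + (1 - l) * z) 0 := by fun_prop
    exact this (by simpa using hN)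
  obtain ⟨δ, hδ, hball⟩ := Metric.eventually_nhds_iff.1 (hlim.and hmem)
  have hne : w - z ≠ 0 := sub_ne_zero.2 hwz
  have hcomb (x : ℝ) : (x - z) / (w - z) * w + (1 - (x - z) / (w - z)) * z = x := by
    field_simp
    ring
  have hkey : ∀ x, (x - z) / (w - z) ∈ Ioo 0 (min δ 1) → x ∈ N ∧ g x < c := by
    intro x hx
    obtain ⟨h0, h1⟩ := hx
    obtain ⟨hlt, hxN⟩ := hball (y := (x - z) / (w - z)) (by
      rw [Real.dist_eq, sub_zero, abs_of_pos h0]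
      exact h1.trans_le (min_le_left _ _))
    rw [hcomb] at hxN
    refine ⟨hxN, lt_of_le_of_lt ?_ hlt⟩
    have := hg w z _ h0.le (h1.le.trans (min_le_right _ _))
    rw [hcomb, ← hp, ← hq] at this
    exact_mod_cast this
  refine ⟨{x | (x - z) / (w - z) ∈ Ioo 0 (min δ 1)},
    isOpen_Ioo.preimage (by fun_prop), ⟨z + min δ 1 / 2 * (w - z), ?_⟩,
    fun x hx => (hkey x hx).1, fun x hx => (hkey x hx).2⟩
  have : 0 < min δ 1 := lt_min hδ one_pos
  rw [mem_ofPred_eq, add_sub_cancel_left, mul_div_cancel_right₀ _ hne]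
  constructor <;> linarith

/-- A convex function does not take the value `⊥` at its unique minimizer. -/
lemma minimum_ne_bot (hg : ConvexERealFn g) {z : ℝ}
    (huniq : ∀ x, (∀ y, g x ≤ g y) → x = z) : g z ≠ ⊥ := by
  intro hbot
  have hmid := hg z (z + 1) (1 / 2) (by norm_num) (by norm_num)
  rw [hbot, EReal.coe_mul_bot_of_pos (by norm_num), EReal.bot_add, le_bot_iff] at hmid
  linarith [huniq _ fun y => hmid ▸ bot_le]

/-- Around the unique minimizer of a convex function which is finite on an open set, a dense set
contains arbitrarily close triples witnessing the location of the minimizer. -/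
lemma exists_triple_of_unique_minimizer (hg : ConvexERealFn g) {z : ℝ} {s : Set ℝ}
    (hs : IsOpen s) (hsne : s.Nonempty) (hfin : ∀ x ∈ s, g x ≠ ⊤ ∧ g x ≠ ⊥)
    (hmin : ∀ x, g z ≤ g x) (huniq : ∀ x, (∀ y, g x ≤ g y) → x = z)
    {D : Set ℝ} (hD : Dense D) {G : Set ℝ} (hG : G ∈ 𝓝 z) :
    ∃ a ∈ D, ∃ t ∈ D, ∃ b ∈ D, a < t ∧ t < b ∧ Icc a b ⊆ G ∧ g t < g a ∧ g t < g b := by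
  obtain ⟨w, hws, hwz : w ≠ z⟩ := (dense_compl_singleton z).inter_open_nonempty s hs hsne
  have hz : g z ≠ ⊤ ∧ g z ≠ ⊥ :=
    ⟨ne_top_of_le_ne_top (hfin w hws).1 (hmin w), hg.minimum_ne_bot huniq⟩
  obtain ⟨l, u, hzlu, hlu⟩ := mem_nhds_iff_exists_Ioo_subset.1 hG
  obtain ⟨a, haD, hla, haz⟩ := hD.exists_between hzlu.1
  obtain ⟨b, hbD, hzb, hbu⟩ := hD.exists_between hzlu.2
  have hlt : ∀ x, x ≠ z → g z < g x := fun x hx => by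
    by_contra! h
    exact hx (huniq x fun y => h.trans (hmin y))
  obtain ⟨v, hv, hvne, hvN, hvlt⟩ := hg.exists_isOpen_lt hwz hz (hfin w hws)
    (lt_min (hlt a haz.ne) (hlt b hzb.ne')) (Ioo_mem_nhds haz hzb)
  obtain ⟨t, htv, htD⟩ := hD.inter_open_nonempty v hv hvne
  exact ⟨a, haD, t, htD, b, hbD, (hvN htv).1, (hvN htv).2,
    (Icc_subset_Ioo hla hbu).trans hlu, lt_min_iff.1 (hvlt t htv)⟩

end ConvexERealFn

/-- The portmanteau inequality on open sets, for random elements of a metrizable space. -/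
lemma measure_preimage_le_liminf_of_tendsto_integral {Ω E : Type*} [MeasurableSpace Ω]
    {P : Measure Ω} [IsProbabilityMeasure P] [TopologicalSpace E] [MeasurableSpace E]
    [BorelSpace E] [TopologicalSpace.PseudoMetrizableSpace E] {X : ℕ → Ω → E} {Y : Ω → E}
    (hX : ∀ n, Measurable (X n)) (hY : Measurable Y)
    (h : ∀ f : E →ᵇ ℝ, Tendsto (fun n => ∫ ω, f (X n ω) ∂P) atTop (𝓝 (∫ ω, f (Y ω) ∂P)))
    {U : Set E} (hU : IsOpen U) :
    P (Y ⁻¹' U) ≤ liminf (fun n => P (X n ⁻¹' U)) atTop := by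
  let := TopologicalSpace.pseudoMetrizableSpacePseudoMetric E
  let μ : ProbabilityMeasure E := ⟨P.map Y, Measure.isProbabilityMeasure_map hY.aemeasurable⟩
  let μs : ℕ → ProbabilityMeasure E := fun n =>
    ⟨P.map (X n), Measure.isProbabilityMeasure_map (hX n).aemeasurable⟩
  have hlim : Tendsto μs atTop (𝓝 μ) := by
    refine ProbabilityMeasure.tendsto_iff_forall_integral_tendsto.2 fun f => ?_
    have hf : StronglyMeasurable f := f.continuous.measurable.stronglyMeasurable
    change Tendsto (fun n => ∫ x, f x ∂(P.map (X n))) atTop (𝓝 (∫ x, f x ∂(P.map Y)))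
    have hmap n := integral_map (hX n).aemeasurable hf.aestronglyMeasurable (μ := P)
    simpa only [hmap, integral_map hY.aemeasurable hf.aestronglyMeasurable] using h f
  have := ProbabilityMeasure.le_liminf_measure_open_of_tendsto hlim hU
  change P.map Y U ≤ liminf (fun n => P.map (X n) U) atTop at this
  have hmap n := Measure.map_apply (hX n) hU.measurableSet (μ := P)
  simpa only [hmap, Measure.map_apply hY hU.measurableSet] using this

/-- Real random variables converge in distribution if they satisfy the portmanteau inequality
on open sets. -/
lemma tendsto_integral_of_measure_preimage_le_liminf {Ω : Type*} [MeasurableSpace Ω]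
    {P : Measure Ω} [IsProbabilityMeasure P] {X : ℕ → Ω → ℝ} {Y : Ω → ℝ}
    (hX : ∀ n, Measurable (X n)) (hY : Measurable Y)
    (h : ∀ G : Set ℝ, IsOpen G → P (Y ⁻¹' G) ≤ liminf (fun n => P (X n ⁻¹' G)) atTop)
    (f : ℝ →ᵇ ℝ) : Tendsto (fun n => ∫ ω, f (X n ω) ∂P) atTop (𝓝 (∫ ω, f (Y ω) ∂P)) := by
  let μ : ProbabilityMeasure ℝ := ⟨P.map Y, Measure.isProbabilityMeasure_map hY.aemeasurable⟩
  let μs : ℕ → ProbabilityMeasure ℝ := fun n =>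
    ⟨P.map (X n), Measure.isProbabilityMeasure_map (hX n).aemeasurable⟩
  have hlim : Tendsto μs atTop (𝓝 μ) := by
    refine tendsto_of_forall_isOpen_le_liminf' fun G hG => ?_
    change P.map Y G ≤ liminf (fun n => P.map (X n) G) atTop
    have hmap n := Measure.map_apply (hX n) hG.measurableSet (μ := P)
    simpa only [hmap, Measure.map_apply hY hG.measurableSet] using h G hG
  have hf : StronglyMeasurable f := f.continuous.measurable.stronglyMeasurable
  have := ProbabilityMeasure.tendsto_iff_forall_integral_tendsto.1 hlim f
  change Tendsto (fun n => ∫ x, f x ∂(P.map (X n))) atTop (𝓝 (∫ x, f x ∂(P.map Y))) at this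
  have hmap n := integral_map (hX n).aemeasurable hf.aestronglyMeasurable (μ := P)
  simpa only [hmap, integral_map hY.aemeasurable hf.aestronglyMeasurable] using this

/-- The vectors of values at `d 0, …, d (m - 1)` which confine the minimizers of a convex function
to `G`. -/
def confiningValues (d : ℕ → ℝ) (G : Set ℝ) (m : ℕ) : Set (Fin m → EReal) :=
  {x | ∃ i j k : Fin m, d i < d j ∧ d j < d k ∧ Icc (d i) (d k) ⊆ G ∧ x j < x i ∧ x j < x k}

lemma isOpen_confiningValues (d : ℕ → ℝ) (G : Set ℝ) (m : ℕ) :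
    IsOpen (confiningValues d G m) := by
  simp only [confiningValues, ofPred_exists]
  refine isOpen_iUnion fun i => isOpen_iUnion fun j => isOpen_iUnion fun k => ?_
  exact isOpen_const.and <| isOpen_const.and <| isOpen_const.and <|
    (isOpen_lt (continuous_apply j) (continuous_apply i)).and
      (isOpen_lt (continuous_apply j) (continuous_apply k))

/-- Lemma B.1 (convexity lemma): if random convex lower-semicontinuous functions `Qₙ`
converge marginally in distribution over a dense set to `Q_∞`, which is finite on a
nonempty open set and a.s. uniquely minimized at `Z_∞`, then any measurable argmin
sequence `Ẑₙ` of `Qₙ` converges in distribution to `Z_∞`. -/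
theorem convexity_argmin_lemma
    {Ω : Type} [MeasurableSpace Ω] (P : Measure Ω) [IsProbabilityMeasure P]
    (Qn : ℕ → Ω → ℝ → EReal) (Qinf : Ω → ℝ → EReal)
    -- random convex lower-semicontinuous functions
    (hQnconvex : ∀ n ω, ConvexERealFn (Qn n ω))
    (hQnlsc : ∀ n ω, LowerSemicontinuous (Qn n ω))
    (hQnmeas : ∀ n, ∀ z : ℝ, Measurable (fun ω => Qn n ω z))
    (hQinfconvex : ∀ ω, ConvexERealFn (Qinf ω))
    (hQinflsc : ∀ ω, LowerSemicontinuous (Qinf ω))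
    (hQinfmeas : ∀ z : ℝ, Measurable (fun ω => Qinf ω z))
    -- (i) finite-dimensional convergence in distribution over a dense set `D`
    (D : Set ℝ) (hD : Dense D)
    (hfidi : ∀ (m : ℕ) (t : Fin m → ℝ), (∀ j, t j ∈ D) →
      ∀ f : BoundedContinuousFunction (Fin m → EReal) ℝ,
        Tendsto (fun n : ℕ => ∫ ω, f (fun j => Qn n ω (t j)) ∂P) atTop
          (𝓝 (∫ ω, f (fun j => Qinf ω (t j)) ∂P)))
    -- (ii) `Q_∞` is a.s. finite over a nonempty open set
    (hfin : ∀ᵐ ω ∂P, ∃ s : Set ℝ, IsOpen s ∧ s.Nonempty ∧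
      ∀ z ∈ s, Qinf ω z ≠ ⊤ ∧ Qinf ω z ≠ ⊥)
    -- (iii) `Q_∞` is a.s. uniquely minimized at the random variable `Z_∞`
    (Zinf : Ω → ℝ) (hZinfmeas : Measurable Zinf)
    (hmin : ∀ᵐ ω ∂P, (∀ z : ℝ, Qinf ω (Zinf ω) ≤ Qinf ω z) ∧
      ∀ z : ℝ, (∀ z' : ℝ, Qinf ω z ≤ Qinf ω z') → z = Zinf ω)
    -- any argmin sequence of `Qₙ`
    (Zhat : ℕ → Ω → ℝ) (hZhatmeas : ∀ n, Measurable (Zhat n))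
    (hZhatmin : ∀ n ω, ∀ z : ℝ, Qn n ω (Zhat n ω) ≤ Qn n ω z) :
    -- conclusion: `Ẑₙ` converges in distribution to `Z_∞`
    ∀ f : BoundedContinuousFunction ℝ ℝ,
      Tendsto (fun n : ℕ => ∫ ω, f (Zhat n ω) ∂P) atTop (𝓝 (∫ ω, f (Zinf ω) ∂P)) := by
  obtain ⟨T, hTD, hTc, hT⟩ := hD.exists_countable_dense_subset
  obtain ⟨d, rfl⟩ := hTc.exists_eq_range hT.nonempty
  refine tendsto_integral_of_measure_preimage_le_liminf hZhatmeas hZinfmeas fun G hG => ?_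
  let A : ℕ → Set Ω := fun m => {ω | (fun j : Fin m => Qinf ω (d j)) ∈ confiningValues d G m}
  have hA : Monotone A := by
    rintro m m' hm ω ⟨i, j, k, h⟩
    exact ⟨i.castLE hm, j.castLE hm, k.castLE hm, h⟩
  have hle (m : ℕ) : P (A m) ≤ liminf (fun n => P (Zhat n ⁻¹' G)) atTop := by
    refine (measure_preimage_le_liminf_of_tendsto_integral
      (fun n => measurable_pi_lambda _ fun j : Fin m => hQnmeas n (d j))
      (measurable_pi_lambda _ fun j : Fin m => hQinfmeas (d j))
      (hfidi m (fun j => d j) fun j => hTD (mem_range_self _))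
      (isOpen_confiningValues d G m)).trans ?_
    refine liminf_le_liminf (Eventually.of_forall fun n => measure_mono ?_)
    rintro ω ⟨i, j, k, hij, hjk, hsub, hi, hk⟩
    exact hsub ((hQnconvex n ω).minimizer_mem_Icc hij hjk hi hk (hZhatmin n ω))
  have hcover : Zinf ⁻¹' G ≤ᵐ[P] ⋃ m, A m := by
    filter_upwards [hfin, hmin] with ω ⟨s, hs, hsne, hsfin⟩ ⟨hω, huniq⟩ hωG
    obtain ⟨_, ⟨i, rfl⟩, _, ⟨j, rfl⟩, _, ⟨k, rfl⟩, h⟩ :=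
      (hQinfconvex ω).exists_triple_of_unique_minimizer hs hsne hsfin hω huniq hT
        (hG.mem_nhds hωG)
    exact mem_iUnion.2 ⟨i + j + k + 1, ⟨i, by omega⟩, ⟨j, by omega⟩, ⟨k, by omega⟩, h⟩
  calc P (Zinf ⁻¹' G) ≤ P (⋃ m, A m) := measure_mono_ae hcover
    _ = ⨆ m, P (A m) := hA.measure_iUnion
    _ ≤ liminf (fun n => P (Zhat n ⁻¹' G)) atTop := iSup_le hle
end

section
/- Let ξ < 0 and let q : (τ̄, 1) → ℝ be differentiable with left limit q(1) := lim_{τ→1⁻} q(τ) finite and q(τ) < q(1) for all τ ∈ (τ̄, 1). Suppose: (i) for all a > b > 0, (q(1 − b·(1−τ)) − q(1 − a·(1−τ)))/(q(1) − q(τ)) → a^{−ξ} − b^{−ξ} as τ → 1⁻; and (ii) the derivative q′ is monotone on (τ₁, 1) for some τ₁ ∈ (τ̄, 1). Then q′(τ)·(1−τ)/(q(1) − q(τ)) → −ξ as τ → 1⁻. -/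
open Filter Set
open scoped Topology

/-- Monotone density argument at the left of `1`: if the increments of `f` between
`1 - a * (1 - τ)` and `1 - b * (1 - τ)`, normalized by `D τ > 0`, converge to `L a - L b` and `f`
has a monotone derivative, then `f' τ * (1 - τ) / D τ` converges to `L' 1`. -/
theorem tendsto_deriv_mul_div_of_monotoneOn_deriv {f D L : ℝ → ℝ} {τ₁ c : ℝ} (hτ₁ : τ₁ < 1)
    (hf : ∀ τ ∈ Ioo τ₁ 1, DifferentiableAt ℝ f τ) (hmono : MonotoneOn (deriv f) (Ioo τ₁ 1))
    (hD : ∀ τ ∈ Ioo τ₁ 1, 0 < D τ) (hL : HasDerivAt L c 1)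
    (hlim : ∀ a b : ℝ, 0 < b → b < a →
      Tendsto (fun τ : ℝ => (f (1 - b * (1 - τ)) - f (1 - a * (1 - τ))) / D τ)
        (𝓝[<] 1) (𝓝 (L a - L b))) :
    Tendsto (fun τ : ℝ => deriv f τ * (1 - τ) / D τ) (𝓝[<] 1) (𝓝 c) := by
  have hIoo : ∀ᶠ τ in 𝓝[<] (1 : ℝ), τ ∈ Ioo τ₁ 1 := Ioo_mem_nhdsLT hτ₁
  have hscale (a : ℝ) : ∀ᶠ τ in 𝓝[<] (1 : ℝ), τ₁ < 1 - a * (1 - τ) := by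
    have h : Tendsto (fun τ : ℝ => 1 - a * (1 - τ)) (𝓝 1) (𝓝 (1 - a * (1 - 1))) :=
      Continuous.tendsto (by fun_prop) 1
    exact (h.mono_left nhdsWithin_le_nhds).eventually (lt_mem_nhds (by simpa using hτ₁))
  have hmvt {x y : ℝ} (hx : τ₁ < x) (hxy : x < y) (hy : y < 1) :
      ∃ z ∈ Ioo x y, f y - f x = deriv f z * (y - x) := by
    have hd (z : ℝ) (hz : z ∈ Icc x y) : DifferentiableAt ℝ f z :=
      hf z ⟨hx.trans_le hz.1, hz.2.trans_lt hy⟩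
    obtain ⟨z, hz, h⟩ := exists_deriv_eq_slope f hxy
      (fun z hz => (hd z hz).continuousAt.continuousWithinAt)
      (fun z hz => (hd z (Ioo_subset_Icc_self hz)).differentiableWithinAt)
    exact ⟨z, hz, by rw [h, div_mul_cancel₀ _ (sub_pos.2 hxy).ne']⟩
  have hslope := hasDerivAt_iff_tendsto_slope.1 hL
  refine tendsto_order.2 ⟨fun l hl => ?_, fun l hl => ?_⟩
  · obtain ⟨a, hla, ha⟩ := (((hslope.mono_left (nhdsWithin_mono _ fun x hx => ne_of_gt hx)
      : Tendsto _ (𝓝[>] (1 : ℝ)) _).eventually (lt_mem_nhds hl)).and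
        self_mem_nhdsWithin).exists
    replace ha : 1 < a := ha
    have ha' : 0 < a - 1 := sub_pos.2 ha
    rw [slope_def_field, lt_div_iff₀ ha'] at hla
    filter_upwards [hIoo, hscale a, (hlim a 1 one_pos ha).eventually (lt_mem_nhds hla)]
      with τ hτ hs h
    have hu : 0 < 1 - τ := sub_pos.2 hτ.2
    have hDτ := hD τ hτ
    obtain ⟨z, hz, hfz⟩ := hmvt hs (show 1 - a * (1 - τ) < τ by nlinarith) hτ.2
    have hle := hmono ⟨hs.trans hz.1, hz.2.trans hτ.2⟩ hτ hz.2.le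
    rw [one_mul, sub_sub_cancel, hfz, lt_div_iff₀ hDτ] at h
    rw [lt_div_iff₀ hDτ]
    have := mul_le_mul_of_nonneg_right hle (mul_pos hu ha').le
    refine lt_of_mul_lt_mul_right ?_ ha'.le
    linarith
  · obtain ⟨b, ⟨hlb, hb⟩, hb0⟩ := ((((hslope.mono_left (nhdsWithin_mono _ fun x hx => ne_of_lt hx)
      : Tendsto _ (𝓝[<] (1 : ℝ)) _).eventually (gt_mem_nhds hl)).and
        self_mem_nhdsWithin).and (Ioo_mem_nhdsLT (zero_lt_one' ℝ))).exists
    replace hb : b < 1 := hb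
    have hb' : 0 < 1 - b := sub_pos.2 hb
    rw [slope_comm, slope_def_field, div_lt_iff₀ hb'] at hlb
    filter_upwards [hIoo, (hlim 1 b hb0.1 hb).eventually (gt_mem_nhds hlb)] with τ hτ h
    have hu : 0 < 1 - τ := sub_pos.2 hτ.2
    have hDτ := hD τ hτ
    have hs : 1 - b * (1 - τ) < 1 := by nlinarith [mul_pos hb0.1 hu]
    obtain ⟨z, hz, hfz⟩ := hmvt hτ.1 (show τ < 1 - b * (1 - τ) by nlinarith) hs
    have hle := hmono hτ ⟨hτ.1.trans hz.1, hz.2.trans hs⟩ hz.1.le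
    rw [one_mul, sub_sub_cancel, hfz, div_lt_iff₀ hDτ] at h
    rw [div_lt_iff₀ hDτ]
    have := mul_le_mul_of_nonneg_right hle (mul_pos hu hb').le
    refine lt_of_mul_lt_mul_right ?_ hb'.le
    linarith

/-- Equation (qprime): if the tail quantile function satisfies the regular-variation property
(i) and its derivative is ultimately monotone (ii), then
`q'(τ)(1-τ)/(q(1) - q(τ)) → -ξ` as `τ → 1⁻`. -/
theorem quantile_derivative_tail_limit
    (ξ : ℝ) (hξ : ξ < 0)
    (τbar : ℝ) (hτbar : τbar < 1)
    (q : ℝ → ℝ) (hdiff : ∀ τ ∈ Set.Ioo τbar 1, DifferentiableAt ℝ q τ)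
    (q1 : ℝ) (hq1 : Tendsto q (𝓝[<] (1:ℝ)) (𝓝 q1))
    (hlt : ∀ τ ∈ Set.Ioo τbar 1, q τ < q1)
    -- (i) tail regular variation of the quantile function
    (hRV : ∀ a b : ℝ, 0 < b → b < a →
      Tendsto (fun τ : ℝ => (q (1 - b * (1 - τ)) - q (1 - a * (1 - τ))) / (q1 - q τ))
        (𝓝[<] (1:ℝ)) (𝓝 (a ^ (-ξ) - b ^ (-ξ))))
    -- (ii) ultimate monotonicity of the derivative
    (hmono : ∃ τ₁ ∈ Set.Ioo τbar 1,
      MonotoneOn (deriv q) (Set.Ioo τ₁ 1) ∨ AntitoneOn (deriv q) (Set.Ioo τ₁ 1)) :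
    Tendsto (fun τ : ℝ => deriv q τ * (1 - τ) / (q1 - q τ)) (𝓝[<] (1:ℝ)) (𝓝 (-ξ)) := by
  obtain ⟨τ₁, hτ₁, hmono⟩ := hmono
  have hsub {τ : ℝ} (hτ : τ ∈ Ioo τ₁ 1) : τ ∈ Ioo τbar 1 := ⟨hτ₁.1.trans hτ.1, hτ.2⟩
  have hD (τ : ℝ) (hτ : τ ∈ Ioo τ₁ 1) : 0 < q1 - q τ := sub_pos.2 (hlt τ (hsub hτ))
  have hL : HasDerivAt (fun t : ℝ => t ^ (-ξ)) (-ξ) 1 := by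
    simpa using Real.hasDerivAt_rpow_const (x := 1) (p := -ξ) (Or.inl one_ne_zero)
  rcases hmono with hmono | hmono
  · exact tendsto_deriv_mul_div_of_monotoneOn_deriv hτ₁.2 (fun τ hτ => hdiff τ (hsub hτ)) hmono
      hD hL hRV
  · have h := tendsto_deriv_mul_div_of_monotoneOn_deriv (f := fun τ => -q τ) hτ₁.2
      (fun τ hτ => (hdiff τ (hsub hτ)).fun_neg) (by simpa only [deriv.fun_neg'] using hmono.neg)
      hD hL.fun_neg fun a b hb hab => by
        convert (hRV a b hb hab).neg using 2 <;> ring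
    convert h.neg using 2
    · rw [deriv.fun_neg]
      ring
    · ring
end
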